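/- Let t ≥ 0, let X be a set with |X| ∈ {3,4}, let n > t, and suppose a_1,…,a_m, b_1,…,b_m ∈ X^n satisfy dist(a_i,b_i) ≥ t+1 for all i ∈ [m] and dist(a_i,b_j) + dist(a_j,b_i) ≤ 2t for all distinct i,j ∈ [m]. Then m ≤ 3^{t+1}. -/

import Mathlib

/-- The coordinates in which `a` and `b` differ and `x` agrees with `b`. -/
def agreeRight {n : ℕ} (a b x : Fin n → Bool) : Finset (Fin n) :=
  {k | a k ≠ b k ∧ x k = b k}

/-- The points `x` that agree with `b` on at most half of all but `t` of the coordinates in which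
`a` and `b` differ, where in case of equality `x` must agree with `b` in the first of them. -/
def nearLeft {n : ℕ} (t : ℕ) (a b : Fin n → Bool) : Finset (Fin n → Bool) :=
  {x | 2 * (agreeRight a b x).card + t < hammingDist a b ∨
    (2 * (agreeRight a b x).card + t = hammingDist a b ∧
      ∃ k, a k ≠ b k ∧ (∀ l < k, a l = b l) ∧ x k = b k)}

theorem hammingDist_cross_identity {n : ℕ} (a b c d x : Fin n → Bool) :
    hammingDist a d + hammingDist c b + 2 * (agreeRight a b x).card
        + 2 * (agreeRight c d x).card =
      hammingDist a b + hammingDist c d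
        + 2 * (Finset.univ.filter fun k => x k ≠ a k ∧ x k = d k).card
        + 2 * (Finset.univ.filter fun k => x k ≠ c k ∧ x k = b k).card := by
  simp only [hammingDist, agreeRight, Finset.card_filter, Finset.mul_sum,
    ← Finset.sum_add_distrib]
  refine Finset.sum_congr rfl fun k _ => ?_
  cases a k <;> cases b k <;> cases c k <;> cases d k <;> cases x k <;> rfl

theorem disjoint_nearLeft {n t : ℕ} {a b c d : Fin n → Bool}
    (h : hammingDist a d + hammingDist c b ≤ 2 * t) :
    Disjoint (nearLeft t a b) (nearLeft t c d) := by
  rw [Finset.disjoint_left]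
  intro x hab hcd
  simp only [nearLeft, Finset.mem_filter, Finset.mem_univ, true_and] at hab hcd
  have key := hammingDist_cross_identity a b c d x
  have had : (Finset.univ.filter fun k => x k ≠ a k ∧ x k = d k).card = 0 := by omega
  have hcb : (Finset.univ.filter fun k => x k ≠ c k ∧ x k = b k).card = 0 := by omega
  rcases hab with hab | ⟨hab, k, hk, hk_min, hxk⟩
  · omega
  rcases hcd with hcd | ⟨-, l, hl, hl_min, hxl⟩
  · omega
  simp only [Finset.card_eq_zero, Finset.filter_eq_empty_iff, Finset.mem_univ, true_implies]
    at had hcb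
  rcases lt_trichotomy k l with hkl | rfl | hkl
  · have := hl_min k hkl
    have := @had k
    have := @hcb k
    grind
  · have := @had k
    grind
  · have := hk_min l hkl
    have := @had l
    have := @hcb l
    grind

theorem two_pow_le_card_nearLeft_mul {n t : ℕ} {a b : Fin n → Bool}
    (h : t + 1 ≤ hammingDist a b) :
    2 ^ n ≤ (nearLeft t a b).card * 2 ^ (t + 1) := by
  classical
  set N : Finset (Fin n) := {k | a k ≠ b k} with hN
  have hN_card : N.card = hammingDist a b := rfl
  have hN_nonempty : N.Nonempty := Finset.card_pos.1 (by omega)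
  set p := N.min' hN_nonempty
  have hpN : p ∈ N := N.min'_mem _
  have hp_ne : a p ≠ b p := by simpa [hN] using hpN
  have hp_min : ∀ l < p, a l = b l := by
    intro l hl
    by_contra hne
    exact absurd (N.min'_le l (by simpa [hN] using hne)) (not_le.2 hl)
  obtain ⟨T, hTN, hT_card⟩ : ∃ T ⊆ N.erase p, T.card = t :=
    Finset.exists_subset_card_eq (by rw [Finset.card_erase_of_mem hpN]; omega)
  have hpT : p ∉ T := fun hmem => by simpa using hTN hmem
  have hT_sub : T ⊆ N := hTN.trans (N.erase_subset p)
  have hR_card : (N \ T).card + t = hammingDist a b := by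
    rw [← hT_card, Finset.card_sdiff_add_card_eq_card hT_sub, hN_card]
  let f : (Fin n → Bool) × Finset (Fin n) × Bool → Fin n → Bool :=
    fun z k => xor (z.1 k) (decide (k ∈ z.2.1 ∨ (z.2.2 = true ∧ k ∈ N \ T)))
  have hsurj : Set.SurjOn f
      ((nearLeft t a b) ×ˢ (T.powerset ×ˢ (Finset.univ : Finset Bool)) :
        Finset ((Fin n → Bool) × Finset (Fin n) × Bool))
      (Finset.univ : Finset (Fin n → Bool)) := by
    intro x _
    let y : Fin n → Bool := fun k => if k ∈ T then a k else x k
    let y' : Fin n → Bool := fun k => if k ∈ T then a k else if k ∈ N then !x k else x k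
    have hcount : (agreeRight a b y).card + (agreeRight a b y').card = (N \ T).card := by
      rw [← Finset.card_union_of_disjoint]
      · congr 1
        ext k
        simp only [agreeRight, y, y', hN, Finset.mem_union, Finset.mem_filter, Finset.mem_univ,
          true_and, Finset.mem_sdiff]
        by_cases hk : k ∈ T <;> cases a k <;> cases b k <;> cases x k <;> simp [hk]
      · rw [Finset.disjoint_left]
        intro k
        simp only [agreeRight, y, y', hN, Finset.mem_filter, Finset.mem_univ, true_and]
        by_cases hk : k ∈ T <;> cases a k <;> cases b k <;> cases x k <;> simp [hk]
    let r : Finset (Fin n) := T.filter fun k => x k ≠ a k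
    have hr : r ⊆ T := Finset.filter_subset _ _
    by_cases hy : y ∈ nearLeft t a b
    · refine ⟨(y, r, false), by simp [hy, hr], ?_⟩
      funext k
      simp only [f, y, r, Finset.mem_filter]
      by_cases hk : k ∈ T <;> simp [hk] <;> cases x k <;> cases a k <;> rfl
    · have hy' : y' ∈ nearLeft t a b := by
        simp only [nearLeft, Finset.mem_filter, Finset.mem_univ, true_and, not_or, not_and,
          not_lt] at hy ⊢
        obtain ⟨hy_ge, hy_tie⟩ := hy
        rcases hy_ge.lt_or_eq with hlt | heq
        · left; omega
        · right
          refine ⟨by omega, p, hp_ne, hp_min, ?_⟩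
          have hyp : y p ≠ b p := fun hyp => hy_tie heq.symm ⟨p, hp_ne, hp_min, hyp⟩
          simp only [y, y', hpT, hpN, if_false, if_true] at hyp ⊢
          exact Bool.not_eq.2 hyp
      refine ⟨(y', r, true), by simp [hy', hr], ?_⟩
      funext k
      simp only [f, y', r, Finset.mem_filter, Finset.mem_sdiff]
      by_cases hk : k ∈ T <;> by_cases hkN : k ∈ N <;> simp [hk, hkN] <;>
        cases x k <;> cases a k <;> rfl
  have hle := Finset.card_le_card_of_surjOn f hsurj
  simpa [Finset.card_product, hT_card, pow_succ] using hle

/-- The bound for binary strings. -/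
theorem card_le_two_pow_of_hammingDist {ι : Type*} {n t : ℕ} (s : Finset ι)
    (a b : ι → Fin n → Bool)
    (h1 : ∀ i ∈ s, t + 1 ≤ hammingDist (a i) (b i))
    (h2 : ∀ i ∈ s, ∀ j ∈ s, i ≠ j →
      hammingDist (a i) (b j) + hammingDist (a j) (b i) ≤ 2 * t) :
    s.card ≤ 2 ^ (t + 1) := by
  classical
  have hdisj : (s : Set ι).PairwiseDisjoint fun i => nearLeft t (a i) (b i) :=
    fun i hi j hj hij => disjoint_nearLeft (h2 i hi j hj hij)
  have hunion : ∑ i ∈ s, (nearLeft t (a i) (b i)).card ≤ 2 ^ n := by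
    rw [← Finset.card_biUnion hdisj]
    simpa using Finset.card_le_univ (s.biUnion fun i => nearLeft t (a i) (b i))
  have hmul : s.card * 2 ^ n ≤ 2 ^ (t + 1) * 2 ^ n :=
    calc s.card * 2 ^ n = ∑ _i ∈ s, 2 ^ n := by simp
      _ ≤ ∑ i ∈ s, (nearLeft t (a i) (b i)).card * 2 ^ (t + 1) :=
        Finset.sum_le_sum fun i hi => two_pow_le_card_nearLeft_mul (h1 i hi)
      _ = (∑ i ∈ s, (nearLeft t (a i) (b i)).card) * 2 ^ (t + 1) := by rw [Finset.sum_mul]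
      _ ≤ 2 ^ n * 2 ^ (t + 1) := Nat.mul_le_mul_right _ hunion
      _ = 2 ^ (t + 1) * 2 ^ n := Nat.mul_comm _ _
  exact Nat.le_of_mul_le_mul_right hmul (by positivity)

/-- The three nonzero linear functionals on `𝔽₂²`. -/
def boolFunctional : Fin 3 → Bool × Bool → Bool :=
  ![fun u => u.1, fun u => u.2, fun u => xor u.1 u.2]

theorem card_boolFunctional_ne :
    ∀ u v : Bool × Bool, u ≠ v →
      (Finset.univ.filter fun f => boolFunctional f u ≠ boolFunctional f v).card = 2 := by
  decide

theorem card_separating_functionals {n t : ℕ} {a b : Fin n → Bool × Bool}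
    (h : t + 1 ≤ hammingDist a b) :
    2 ^ (t + 1) * 3 ^ n ≤ 3 ^ (t + 1) * (Finset.univ.filter fun F : Fin n → Fin 3 =>
      t + 1 ≤ hammingDist (fun k => boolFunctional (F k) (a k))
        (fun k => boolFunctional (F k) (b k))).card := by
  classical
  obtain ⟨T, hT_sub, hT_card⟩ := Finset.exists_subset_card_eq h
  let S : Fin n → Finset (Fin 3) := fun k =>
    if k ∈ T then Finset.univ.filter fun f => boolFunctional f (a k) ≠ boolFunctional f (b k)
    else Finset.univ
  have hS : ∀ k, (S k).card = if k ∈ T then 2 else 3 := by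
    intro k
    by_cases hk : k ∈ T
    · have hne : a k ≠ b k := by simpa using hT_sub hk
      simpa [S, hk] using card_boolFunctional_ne _ _ hne
    · simp [S, hk]
  have hpi : 3 ^ (t + 1) * (Fintype.piFinset S).card = 2 ^ (t + 1) * 3 ^ n := by
    have hcompl : (Tᶜ).card + (t + 1) = n := by
      rw [← hT_card, Finset.card_compl_add_card, Fintype.card_fin]
    have hprod : (Fintype.piFinset S).card = 2 ^ (t + 1) * 3 ^ (Tᶜ).card := by
      rw [Fintype.card_piFinset, Finset.prod_congr rfl fun k _ => hS k,
        ← Finset.prod_mul_prod_compl T,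
        Finset.prod_congr rfl fun k hk => if_pos hk,
        Finset.prod_congr (s₁ := Tᶜ) rfl fun k hk => if_neg (Finset.mem_compl.1 hk),
        Finset.prod_const, Finset.prod_const, hT_card]
    have hpow : 3 ^ n = 3 ^ (Tᶜ).card * 3 ^ (t + 1) := by rw [← pow_add, hcompl]
    rw [hprod, hpow]
    ring
  rw [← hpi]
  refine Nat.mul_le_mul_left _ (Finset.card_le_card fun F hF => ?_)
  rw [Fintype.mem_piFinset] at hF
  rw [Finset.mem_filter]
  refine ⟨Finset.mem_univ _, hT_card.symm.le.trans (Finset.card_le_card fun k hk => ?_)⟩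
  simpa [S, hk] using hF k

theorem card_le_three_pow_of_hammingDist {m n t : ℕ} (a b : Fin m → Fin n → Bool × Bool)
    (h1 : ∀ i, t + 1 ≤ hammingDist (a i) (b i))
    (h2 : ∀ i j, i ≠ j →
      hammingDist (a i) (b j) + hammingDist (a j) (b i) ≤ 2 * t) :
    m ≤ 3 ^ (t + 1) := by
  classical
  let P : (Fin n → Fin 3) → (Fin n → Bool × Bool) → Fin n → Bool :=
    fun F u k => boolFunctional (F k) (u k)
  have hP : ∀ F u v, hammingDist (P F u) (P F v) ≤ hammingDist u v := fun F _ _ =>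
    hammingDist_comp_le_hammingDist (fun k => boolFunctional (F k))
  let sep : Fin m → (Fin n → Fin 3) → Prop :=
    fun i F => t + 1 ≤ hammingDist (P F (a i)) (P F (b i))
  have hbinary : ∀ F, (Finset.univ.filter fun i => sep i F).card ≤ 2 ^ (t + 1) := fun F =>
    card_le_two_pow_of_hammingDist _ (fun i => P F (a i)) (fun i => P F (b i))
      (fun i hi => (Finset.mem_filter.1 hi).2)
      (fun i _ j _ hij => (Nat.add_le_add (hP F _ _) (hP F _ _)).trans (h2 i j hij))
  have hdouble : ∑ i, (Finset.univ.filter fun F => sep i F).card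
      = ∑ F, (Finset.univ.filter fun i => sep i F).card :=
    Finset.sum_card_bipartiteAbove_eq_sum_card_bipartiteBelow sep
  have hmul : m * (2 ^ (t + 1) * 3 ^ n) ≤ 3 ^ (t + 1) * (2 ^ (t + 1) * 3 ^ n) :=
    calc m * (2 ^ (t + 1) * 3 ^ n) = ∑ _i : Fin m, 2 ^ (t + 1) * 3 ^ n := by simp
      _ ≤ ∑ i, 3 ^ (t + 1) * (Finset.univ.filter fun F => sep i F).card :=
        Finset.sum_le_sum fun i _ => by
          convert card_separating_functionals (h1 i)
      _ = 3 ^ (t + 1) * ∑ F, (Finset.univ.filter fun i => sep i F).card := by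
        rw [← Finset.mul_sum, hdouble]
      _ ≤ 3 ^ (t + 1) * ∑ _F : Fin n → Fin 3, 2 ^ (t + 1) :=
        Nat.mul_le_mul_left _ (Finset.sum_le_sum fun F _ => hbinary F)
      _ = 3 ^ (t + 1) * (2 ^ (t + 1) * 3 ^ n) := by simp [mul_comm]
  exact Nat.le_of_mul_le_mul_right hmul (by positivity)

theorem stmt_10 (n t : ℕ) (ht : t < n) (X : Type*) [DecidableEq X] [Fintype X]
    (hX : Fintype.card X = 3 ∨ Fintype.card X = 4)
    (m : ℕ) (a b : Fin m → (Fin n → X))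
    (h1 : ∀ i, t + 1 ≤ hammingDist (a i) (b i))
    (h2 : ∀ i j, i ≠ j →
      hammingDist (a i) (b j) + hammingDist (a j) (b i) ≤ 2 * t) :
    m ≤ 3 ^ (t + 1) := by
  have hcard : Fintype.card X ≤ Fintype.card (Bool × Bool) := by
    rw [Fintype.card_prod, Fintype.card_bool]
    omega
  obtain ⟨g⟩ := Function.Embedding.nonempty_of_card_le hcard
  have hg : ∀ u v : Fin n → X,
      hammingDist (fun k => g (u k)) (fun k => g (v k)) = hammingDist u v := fun _ _ =>
    hammingDist_comp (fun _ => g) fun _ => g.injective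
  exact card_le_three_pow_of_hammingDist (fun i k => g (a i k)) (fun i k => g (b i k))
    (fun i => by simpa only [hg] using h1 i)
    (fun i j hij => by simpa only [hg] using h2 i j hij)
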